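/- arXiv:2110.13796 — 2 statements merged into one kernel-verified Lean document; each statement's English description precedes it below -/
import Mathlib

section
/- Let K ≥ 2. For y ∈ ℝ^K with strictly positive entries summing to 1, define its natural parameter η(y) ∈ ℝ^{K−1} by η(y)_j = log(y_j / y_K) for 1 ≤ j ≤ K−1, and define the log-partition function A : ℝ^{K−1} → ℝ by A(η) = log(1 + Σ_{j=1}^{K−1} e^{η_j}). Fix λ ≥ 0, nonnegative weights W_{ij} for j ≠ i, a probability vector ŷ_i with strictly positive entries, and probability vectors ỹ_j (j ≠ i) with strictly positive entries. If η̃_i is the unique minimizer over η ∈ ℝ^{K−1} of ‖η − η(ŷ_i)‖² + (λ/2) Σ_{j≠i} W_{ij} ‖η − η(ỹ_j)‖², then the probability vector ỹ_i whose natural parameter is η̃_i minimizes, over probability vectors y ∈ Δ^K with positive entries, the objective KL(y ‖ ŷ_i) + (λ/2) Σ_{j≠i} W_{ij} KL(y ‖ ỹ_j), where KL(y ‖ y') = Σ_{k=1}^K y_k log(y_k / y'_k). -/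
open Finset

/-- (KL Laplacian smoothing reduces to least squares in logit
space.) With `K = m + 1 ≥ 2`, natural parameters `η(y)_j = log(y_j / y_K)`,
if `η*` is the unique minimizer of
`‖η − η(ŷ_i)‖² + (λ/2) Σ_{j≠i} W_{ij} ‖η − η(ỹ_j)‖²`,
then the probability vector with natural parameter `η*` minimizes
`KL(y‖ŷ_i) + (λ/2) Σ_{j≠i} W_{ij} KL(y‖ỹ_j)` over positive probability
vectors `y ∈ Δ^K`. -/
theorem stmt8 (m : ℕ) (hm : 1 ≤ m)
    (natParam : (Fin (m + 1) → ℝ) → (Fin m → ℝ))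
    (hnat : ∀ (y : Fin (m + 1) → ℝ) (j : Fin m),
      natParam y j = Real.log (y j.castSucc / y (Fin.last m)))
    (toProb : (Fin m → ℝ) → (Fin (m + 1) → ℝ))
    (htoProb : ∀ η : Fin m → ℝ, toProb η =
      Fin.snoc (fun j => Real.exp (η j) / (1 + ∑ l, Real.exp (η l)))
        (1 / (1 + ∑ l, Real.exp (η l))))
    (lam : ℝ) (hlam : 0 ≤ lam)
    (J : Type*) [Fintype J]
    (w : J → ℝ) (hw : ∀ j, 0 ≤ w j)
    (yhat : Fin (m + 1) → ℝ)
    (hyhat : (∀ k, 0 < yhat k) ∧ ∑ k, yhat k = 1)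
    (ytil : J → Fin (m + 1) → ℝ)
    (hytil : ∀ j, (∀ k, 0 < ytil j k) ∧ ∑ k, ytil j k = 1)
    (Q : (Fin m → ℝ) → ℝ)
    (hQ : ∀ η : Fin m → ℝ, Q η =
      (∑ i, (η i - natParam yhat i) ^ 2) +
        (lam / 2) * ∑ j, w j * ∑ i, (η i - natParam (ytil j) i) ^ 2)
    (ηstar : Fin m → ℝ)
    (hmin : ∀ η : Fin m → ℝ, η ≠ ηstar → Q ηstar < Q η)
    (KLobj : (Fin (m + 1) → ℝ) → ℝ)
    (hKLobj : ∀ y : Fin (m + 1) → ℝ, KLobj y =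
      (∑ k, y k * Real.log (y k / yhat k)) +
        (lam / 2) * ∑ j, w j * ∑ k, y k * Real.log (y k / ytil j k)) :
    ∀ y : Fin (m + 1) → ℝ, (∀ k, 0 < y k) → (∑ k, y k = 1) →
      KLobj (toProb ηstar) ≤ KLobj y := by
  intro y hy hysum
  set c := lam / 2 with hc
  have hc0 : 0 ≤ c := by positivity
  obtain ⟨S, hS⟩ : ∃ S, S = 1 + c * ∑ j, w j := ⟨_, rfl⟩
  have hS0 : 0 < S := by
    have : 0 ≤ c * ∑ j, w j := mul_nonneg hc0 (Finset.sum_nonneg fun j _ => hw j)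
    linarith
  obtain ⟨b, hb⟩ : ∃ b : Fin m → ℝ, ∀ i, b i = natParam yhat i + c * ∑ j, w j * natParam (ytil j) i :=
    ⟨_, fun _ => rfl⟩
  have hQ2 : ∀ η, Q η = ∑ i, (S * η i ^ 2 - 2 * b i * η i + (natParam yhat i ^ 2
      + c * ∑ j, w j * natParam (ytil j) i ^ 2)) := by
    intro η
    rw [hQ]
    simp_rw [Finset.mul_sum]
    rw [Finset.sum_comm, ← Finset.sum_add_distrib]
    refine Finset.sum_congr rfl fun i _ => ?_
    have e : ∑ j, c * (w j * (η i - natParam (ytil j) i) ^ 2) =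
        (c * ∑ j, w j) * η i ^ 2 - 2 * (c * ∑ j, w j * natParam (ytil j) i) * η i
          + ∑ j, c * (w j * natParam (ytil j) i ^ 2) := by
      simp only [Finset.mul_sum, Finset.sum_mul]
      rw [← Finset.sum_sub_distrib, ← Finset.sum_add_distrib]
      exact Finset.sum_congr rfl fun j _ => by ring
    rw [e, hb, hS]
    ring
  have hη : ∀ i, S * ηstar i = b i := by
    have h0 : (fun i => b i / S) = ηstar := by
      by_contra hne
      have h1 := hmin _ hne
      rw [hQ2, hQ2] at h1
      refine absurd h1 (not_lt.mpr (Finset.sum_le_sum fun i _ => ?_))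
      have h2 : b i = S * (b i / S) := by field_simp
      have h3 : 0 ≤ S * (ηstar i - b i / S) ^ 2 := by positivity
      generalize b i / S = t at h2 h3 ⊢
      rw [h2]
      nlinarith
    intro i
    rw [← h0]
    field_simp
  obtain ⟨L, hL⟩ : ∃ L : Fin (m + 1) → ℝ, ∀ k, L k = Real.log (yhat k)
      + c * ∑ j, w j * Real.log (ytil j k) := ⟨_, fun _ => rfl⟩
  have hbL : ∀ i : Fin m, b i = L i.castSucc - L (Fin.last m) := by
    intro i
    rw [hb, hL, hL, hnat, Real.log_div (hyhat.1 _).ne' (hyhat.1 _).ne']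
    have e : ∑ j, w j * natParam (ytil j) i = ∑ j, w j * Real.log (ytil j i.castSucc)
        - ∑ j, w j * Real.log (ytil j (Fin.last m)) := by
      rw [← Finset.sum_sub_distrib]
      refine Finset.sum_congr rfl fun j _ => ?_
      rw [hnat, Real.log_div ((hytil j).1 _).ne' ((hytil j).1 _).ne']
      ring
    rw [e]
    ring
  obtain ⟨p, hp⟩ : ∃ p, p = toProb ηstar := ⟨_, rfl⟩
  obtain ⟨Z, hZ⟩ : ∃ Z, Z = 1 + ∑ l, Real.exp (ηstar l) := ⟨_, rfl⟩
  have hZ0 : 0 < Z := by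
    have : 0 ≤ ∑ l, Real.exp (ηstar l) := Finset.sum_nonneg fun l _ => (Real.exp_pos _).le
    linarith
  have hpc : ∀ i : Fin m, p i.castSucc = Real.exp (ηstar i) / Z := by
    intro i; rw [hp, htoProb, hZ]; simp
  have hpl : p (Fin.last m) = 1 / Z := by
    rw [hp, htoProb, hZ]; simp
  have hp0 : ∀ k, 0 < p k := by
    intro k
    refine Fin.lastCases ?_ (fun i => ?_) k
    · rw [hpl]; positivity
    · rw [hpc]; positivity
  have hps : ∑ k, p k = 1 := by
    rw [Fin.sum_univ_castSucc, hpl]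
    simp_rw [hpc]
    rw [← Finset.sum_div, ← add_div, add_comm, ← hZ, div_self hZ0.ne']
  have hLp : ∀ k, L k = S * Real.log (p k) + (L (Fin.last m) + S * Real.log Z) := by
    intro k
    refine Fin.lastCases ?_ (fun i => ?_) k
    · rw [hpl, one_div, Real.log_inv]; ring
    · rw [hpc, Real.log_div (Real.exp_pos _).ne' hZ0.ne', Real.log_exp]
      linarith [hη i, hbL i]
  have hKL : ∀ z : Fin (m + 1) → ℝ, (∀ k, 0 < z k) → ∑ k, z k = 1 →
      KLobj z = S * ∑ k, z k * (Real.log (z k) - Real.log (p k))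
        - (L (Fin.last m) + S * Real.log Z) := by
    intro z hz hzs
    have e1 : KLobj z = ∑ k, z k * (S * Real.log (z k) - L k) := by
      rw [hKLobj]
      simp_rw [Finset.mul_sum]
      rw [Finset.sum_comm, ← Finset.sum_add_distrib]
      refine Finset.sum_congr rfl fun k _ => ?_
      have e : ∑ j, c * (w j * (z k * Real.log (z k / ytil j k))) =
          z k * ((c * ∑ j, w j) * Real.log (z k) - c * ∑ j, w j * Real.log (ytil j k)) := by
        simp only [Finset.mul_sum, Finset.sum_mul]
        rw [← Finset.sum_sub_distrib, Finset.mul_sum]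
        refine Finset.sum_congr rfl fun j _ => ?_
        rw [Real.log_div (hz _).ne' ((hytil j).1 _).ne']
        ring
      rw [e, hL, hS, Real.log_div (hz _).ne' (hyhat.1 _).ne']
      ring
    rw [e1]
    generalize hD : L (Fin.last m) + S * Real.log Z = D at hLp ⊢
    have e2 : D = ∑ k, z k * D := by rw [← Finset.sum_mul, hzs, one_mul]
    rw [e2, Finset.mul_sum, ← Finset.sum_sub_distrib]
    refine Finset.sum_congr rfl fun k _ => ?_
    rw [hLp k]
    ring
  have hG : 0 ≤ ∑ k, y k * (Real.log (y k) - Real.log (p k)) := by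
    have h1 : ∑ k, (y k - p k) ≤ ∑ k, y k * (Real.log (y k) - Real.log (p k)) := by
      refine Finset.sum_le_sum fun k _ => ?_
      have h2 := Real.log_le_sub_one_of_pos (div_pos (hp0 k) (hy k))
      rw [Real.log_div (hp0 k).ne' (hy k).ne'] at h2
      have h3 := mul_le_mul_of_nonneg_left h2 (hy k).le
      have h4 : y k * (p k / y k - 1) = p k - y k := by
        have := (hy k).ne'
        field_simp
      linarith
    rw [Finset.sum_sub_distrib, hysum, hps] at h1
    linarith
  rw [← hp, hKL p hp0 hps, hKL y hy hysum]
  have := mul_nonneg hS0.le hG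
  simp only [sub_self, mul_zero, Finset.sum_const_zero]
  linarith
end

section
/- Let X ⊂ ℝ^d be compact, let p be a probability density supported on X with p_min ≤ p(x) ≤ p_max on X (0 < p_min ≤ p_max < ∞) and with uniformly bounded derivatives up to order 2, and let f : X → ℝ have uniformly bounded derivatives up to order 2 with ∇f(x) = 0 for all x on the boundary of X. Then, as h ↓ 0, (1/h²) ∫_X ∫_X (2π)^{−d/2} h^{−d} exp(−‖x−y‖²/(2h²)) (f(x) − f(y))² p(y) p(x) dy dx converges to ∫_X ‖∇f(x)‖² p(x)² dx = E_{X∼p}[‖∇f(X)‖² p(X)]. -/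
open MeasureTheory Filter Topology Real

/-- standard Gaussian density -/
noncomputable def s17phi {d : ℕ} (z : Fin d → ℝ) : ℝ :=
  ∏ k, ProbabilityTheory.gaussianPDFReal 0 1 (z k)

lemma s17phi_nonneg {d : ℕ} (z : Fin d → ℝ) : 0 ≤ s17phi z :=
  Finset.prod_nonneg fun _ _ => ProbabilityTheory.gaussianPDFReal_nonneg _ _ _

lemma s17phi_meas {d : ℕ} : Measurable (s17phi (d := d)) := by
  unfold s17phi
  refine Finset.measurable_prod _ fun k _ => ?_
  exact (ProbabilityTheory.measurable_gaussianPDFReal 0 1).comp (measurable_pi_apply k)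

lemma s17phi_eq {d : ℕ} (z : Fin d → ℝ) :
    s17phi z = (2 * π) ^ (-(d : ℝ) / 2) * Real.exp (-(∑ i, z i ^ 2) / 2) := by
  unfold s17phi ProbabilityTheory.gaussianPDFReal
  rw [Finset.prod_mul_distrib, ← Real.exp_sum]
  congr 1
  · simp only [NNReal.coe_one, mul_one, Finset.prod_const, Finset.card_univ, Fintype.card_fin]
    rw [Real.sqrt_eq_rpow, ← Real.rpow_neg (by positivity), ← Real.rpow_natCast,
      ← Real.rpow_mul (by positivity)]
    congr 1
    ring
  · congr 1
    simp [Finset.sum_div, ← Finset.sum_neg_distrib, neg_div]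

lemma s17_int1 (n : ℕ) :
    Integrable (fun t : ℝ => t ^ n * ProbabilityTheory.gaussianPDFReal 0 1 t) := by
  have h := integrable_rpow_mul_exp_neg_mul_sq (b := 1/2) (by norm_num) (s := (n : ℝ))
    (by have : (0:ℝ) ≤ n := Nat.cast_nonneg n
        linarith)
  have h2 := h.const_mul ((√(2 * π))⁻¹)
  refine h2.congr (ae_of_all _ fun t => ?_)
  simp only [Real.rpow_natCast, ProbabilityTheory.gaussianPDFReal, NNReal.coe_one, mul_one, sub_zero]
  rw [show -t ^ 2 / 2 = -(1/2) * t ^ 2 by ring]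
  ring

lemma s17_m0 : ∫ t : ℝ, t ^ 0 * ProbabilityTheory.gaussianPDFReal 0 1 t = 1 := by
  simpa using ProbabilityTheory.integral_gaussianPDFReal_eq_one 0 (v := 1) one_ne_zero

lemma s17_m1 : ∫ t : ℝ, t ^ 1 * ProbabilityTheory.gaussianPDFReal 0 1 t = 0 := by
  have h := ProbabilityTheory.integral_id_gaussianReal (μ := 0) (v := 1)
  rw [ProbabilityTheory.integral_gaussianReal_eq_integral_smul one_ne_zero] at h
  simpa [mul_comm] using h

lemma s17_m2 : ∫ t : ℝ, t ^ 2 * ProbabilityTheory.gaussianPDFReal 0 1 t = 1 := by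
  have h := ProbabilityTheory.variance_id_gaussianReal (μ := 0) (v := 1)
  rw [ProbabilityTheory.variance_of_integral_eq_zero (by fun_prop)
    (by simpa using ProbabilityTheory.integral_id_gaussianReal (μ := 0) (v := 1)),
    ProbabilityTheory.integral_gaussianReal_eq_integral_smul one_ne_zero] at h
  simpa [mul_comm] using h

lemma s17_prod {d : ℕ} (i j : Fin d) (z : Fin d → ℝ) :
    s17phi z * (z i * z j) = ∏ k, ((z k) ^ ((if k = i then 1 else 0) + (if k = j then 1 else 0) : ℕ)
      * ProbabilityTheory.gaussianPDFReal 0 1 (z k)) := by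
  rw [Finset.prod_mul_distrib, mul_comm]
  congr 1
  simp_rw [pow_add, Finset.prod_mul_distrib]
  simp [pow_ite]

lemma s17_integrable {d : ℕ} (i j : Fin d) :
    Integrable (fun z : Fin d → ℝ => s17phi z * (z i * z j)) := by
  simp_rw [s17_prod]
  exact Integrable.fintype_prod (f := fun k t =>
    t ^ ((if k = i then 1 else 0) + (if k = j then 1 else 0) : ℕ)
      * ProbabilityTheory.gaussianPDFReal 0 1 t) (fun k => s17_int1 _)

lemma s17_integral {d : ℕ} (i j : Fin d) :
    ∫ z : Fin d → ℝ, s17phi z * (z i * z j) = if i = j then 1 else 0 := by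
  simp_rw [s17_prod]
  rw [integral_fintype_prod_volume_eq_prod (fun k t =>
    t ^ ((if k = i then 1 else 0) + (if k = j then 1 else 0) : ℕ)
      * ProbabilityTheory.gaussianPDFReal 0 1 t)]
  split_ifs with h
  · subst h
    refine Finset.prod_eq_one fun k _ => ?_
    by_cases hk : k = i
    · simp only [hk, if_true]
      exact s17_m2
    · simp only [hk, if_false]
      exact s17_m0
  · refine Finset.prod_eq_zero (Finset.mem_univ i) ?_
    simp only [h, if_true, if_false]
    exact s17_m1

lemma s17_quad {d : ℕ} (L : (Fin d → ℝ) →L[ℝ] ℝ) :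
    ∫ z : Fin d → ℝ, s17phi z * (L z) ^ 2 = ∑ i, L (Pi.single i 1) ^ 2 := by
  have h : ∀ z : Fin d → ℝ, s17phi z * (L z) ^ 2 =
      ∑ i, ∑ j, (L (Pi.single i 1) * L (Pi.single j 1)) * (s17phi z * (z i * z j)) := by
    intro z
    have : L z = ∑ i, z i * L (Pi.single i 1) := by
      conv_lhs => rw [← Finset.univ_sum_single z]
      rw [map_sum]
      refine Finset.sum_congr rfl fun i _ => ?_
      rw [← smul_eq_mul, ← map_smul, ← Pi.single_smul]
      simp
    rw [this, pow_two, Finset.sum_mul_sum, Finset.mul_sum]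
    refine Finset.sum_congr rfl fun i _ => ?_
    rw [Finset.mul_sum]
    refine Finset.sum_congr rfl fun j _ => ?_
    ring
  simp_rw [h]
  rw [integral_finsetSum _ fun i _ => integrable_finsetSum _ fun j _ =>
    (s17_integrable i j).const_mul _]
  refine Finset.sum_congr rfl fun i _ => ?_
  rw [integral_finsetSum _ fun j _ => (s17_integrable i j).const_mul _]
  simp_rw [integral_const_mul, s17_integral]
  simp [pow_two]

/-- rescaled integrand -/
noncomputable def s17G {d : ℕ} (𝒳 : Set (Fin d → ℝ)) (p f : (Fin d → ℝ) → ℝ) (h : ℝ)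
    (x z : Fin d → ℝ) : ℝ :=
  (𝒳.indicator p (x + h • z)) * (s17phi z * ((f (x + h • z) - f x) / h) ^ 2)

lemma s17_cov {d : ℕ} (𝒳 : Set (Fin d → ℝ)) (h𝒳 : MeasurableSet 𝒳) (p f : (Fin d → ℝ) → ℝ)
    (h : ℝ) (hh : 0 < h) (x : Fin d → ℝ) :
    (1 / h ^ 2) * (∫ y in 𝒳,
          (2 * π) ^ (-(d : ℝ) / 2) * h ^ (-(d : ℤ)) *
            Real.exp (-(∑ i, (x i - y i) ^ 2) / (2 * h ^ 2)) *
            (f x - f y) ^ 2 * p y) = ∫ z, s17G 𝒳 p f h x z := by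
  set F : (Fin d → ℝ) → ℝ := fun y => (2 * π) ^ (-(d : ℝ) / 2) * h ^ (-(d : ℤ)) *
            Real.exp (-(∑ i, (x i - y i) ^ 2) / (2 * h ^ 2)) *
            (f x - f y) ^ 2 * p y with hF
  rw [← integral_indicator h𝒳, ← integral_add_left_eq_self _ x]
  have h1 := Measure.integral_comp_smul (volume : Measure (Fin d → ℝ))
    (fun y => 𝒳.indicator F (x + y)) h
  simp only [Module.finrank_fin_fun, smul_eq_mul] at h1
  have h2 : ∀ z, s17G 𝒳 p f h x z = (h ^ d / h ^ 2) * 𝒳.indicator F (x + h • z) := by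
    intro z
    unfold s17G
    by_cases hz : x + h • z ∈ 𝒳
    · rw [Set.indicator_of_mem hz, Set.indicator_of_mem hz, hF, s17phi_eq]
      have e : -(∑ i, (x i - (x + h • z) i) ^ 2) / (2 * h ^ 2) = -(∑ i, z i ^ 2) / 2 := by
        have : ∀ i, (x i - (x + h • z) i) ^ 2 = h ^ 2 * z i ^ 2 := by
          intro i
          simp only [Pi.add_apply, Pi.smul_apply, smul_eq_mul]
          ring
        simp_rw [this, ← Finset.mul_sum]
        field_simp
      simp only [e, zpow_neg, zpow_natCast]
      field_simp
      ring
    · rw [Set.indicator_of_notMem hz, Set.indicator_of_notMem hz]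
      simp
  simp_rw [h2]
  rw [integral_const_mul, h1, abs_of_pos (by positivity)]
  change 1 / h ^ 2 * (∫ y, 𝒳.indicator F (x + y)) = _
  generalize (∫ y, 𝒳.indicator F (x + y)) = I
  field_simp

lemma s17_bound {d : ℕ} (𝒳 : Set (Fin d → ℝ)) (p f : (Fin d → ℝ) → ℝ)
    (pmax : ℝ) (hp : ∀ x ∈ 𝒳, 0 ≤ p x ∧ p x ≤ pmax) (K : NNReal) (hK : LipschitzOnWith K f 𝒳)
    (h : ℝ) (hh : 0 < h) (x : Fin d → ℝ) (hx : x ∈ 𝒳) (z : Fin d → ℝ) :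
    ‖s17G 𝒳 p f h x z‖ ≤ pmax * K ^ 2 * ∑ i, s17phi z * (z i * z i) := by
  have hpm : 0 ≤ pmax := (hp x hx).1.trans (hp x hx).2
  have hφ := s17phi_nonneg z
  have hS : ‖z‖ ^ 2 ≤ ∑ i, z i * z i := by
    have hS0 : 0 ≤ ∑ i, z i * z i := Finset.sum_nonneg fun i _ => mul_self_nonneg _
    have : ‖z‖ ≤ √(∑ i, z i * z i) := by
      refine (pi_norm_le_iff_of_nonneg (Real.sqrt_nonneg _)).2 fun i => ?_
      rw [Real.norm_eq_abs]
      apply Real.abs_le_sqrt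
      rw [pow_two]
      exact Finset.single_le_sum (f := fun i => z i * z i) (fun i _ => mul_self_nonneg _)
        (Finset.mem_univ i)
    calc ‖z‖ ^ 2 ≤ √(∑ i, z i * z i) ^ 2 := by gcongr
      _ = _ := Real.sq_sqrt hS0
  unfold s17G
  rw [← Finset.mul_sum]
  by_cases hz : x + h • z ∈ 𝒳
  · rw [Set.indicator_of_mem hz, Real.norm_eq_abs, abs_of_nonneg
      (mul_nonneg (hp _ hz).1 (by positivity))]
    have hl : |(f (x + h • z) - f x) / h| ≤ K * ‖z‖ := by
      have := hK.dist_le_mul _ hz _ hx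
      rw [Real.dist_eq, dist_eq_norm, add_sub_cancel_left, norm_smul, Real.norm_eq_abs,
        abs_of_pos hh] at this
      rw [abs_div, abs_of_pos hh, div_le_iff₀ hh]
      linarith
    have hl2 : ((f (x + h • z) - f x) / h) ^ 2 ≤ K ^ 2 * ∑ i, z i * z i := by
      calc _ = |(f (x + h • z) - f x) / h| ^ 2 := (sq_abs _).symm
        _ ≤ (K * ‖z‖) ^ 2 := by gcongr
        _ = K ^ 2 * ‖z‖ ^ 2 := by ring
        _ ≤ _ := by gcongr
    calc _ ≤ pmax * (s17phi z * (K ^ 2 * ∑ i, z i * z i)) := by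
            gcongr
            exact (hp _ hz).2
      _ = _ := by ring
  · rw [Set.indicator_of_notMem hz, zero_mul, norm_zero]
    have hS0 : 0 ≤ ∑ i, z i * z i := Finset.sum_nonneg fun i _ => mul_self_nonneg _
    positivity

lemma s17_ptwise {d : ℕ} (𝒳 : Set (Fin d → ℝ)) (h𝒳 : IsClosed 𝒳) (p f : (Fin d → ℝ) → ℝ)
    (hpc : Continuous p) (hf : Differentiable ℝ f)
    (pmax : ℝ) (hp : ∀ x ∈ 𝒳, 0 ≤ p x ∧ p x ≤ pmax)
    (hbd : ∀ x ∈ frontier 𝒳, fderiv ℝ f x = 0)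
    (x : Fin d → ℝ) (hx : x ∈ 𝒳) (z : Fin d → ℝ) :
    Tendsto (fun h : ℝ => s17G 𝒳 p f h x z) (𝓝[>] 0)
      (𝓝 (p x * (s17phi z * (fderiv ℝ f x z) ^ 2))) := by
  have hpm : 0 ≤ pmax := (hp x hx).1.trans (hp x hx).2
  have hq : Tendsto (fun h : ℝ => (f (x + h • z) - f x) / h) (𝓝[>] 0) (𝓝 (fderiv ℝ f x z)) := by
    have h1 := ((hf x).hasFDerivAt.hasLineDerivAt z)
    have h2 : HasDerivAt (fun t : ℝ => f (x + t • z)) (fderiv ℝ f x z) 0 := h1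
    have h3 := h2.tendsto_slope_zero_right
    simpa [div_eq_inv_mul] using h3
  have hq2 := (hq.pow 2).const_mul (s17phi z)
  have hc : Tendsto (fun h : ℝ => x + h • z) (𝓝[>] 0) (𝓝 x) := by
    have : Continuous (fun h : ℝ => x + h • z) := by fun_prop
    have := (this.tendsto 0).mono_left (nhdsWithin_le_nhds (s := Set.Ioi 0))
    simpa using this
  unfold s17G
  by_cases hi : x ∈ interior 𝒳
  · refine Tendsto.mul ?_ hq2
    have : Tendsto (fun h : ℝ => p (x + h • z)) (𝓝[>] 0) (𝓝 (p x)) :=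
      (hpc.tendsto x).comp hc
    refine this.congr' ?_
    filter_upwards [hc.eventually (mem_interior_iff_mem_nhds.1 hi)] with h hh
    rw [Set.indicator_of_mem hh]
  · have h0 := hbd x ⟨subset_closure hx, hi⟩
    rw [h0] at hq2 ⊢
    simp only [ContinuousLinearMap.zero_apply, ne_eq, OfNat.ofNat_ne_zero, not_false_eq_true,
      zero_pow, mul_zero] at hq2 ⊢
    have := hq2.zero_mul_isBoundedUnder_le (g := fun h : ℝ => 𝒳.indicator p (x + h • z)) ?_
    · simpa [mul_comm] using this
    · refine isBoundedUnder_of ⟨pmax, fun h => ?_⟩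
      simp only [Function.comp]
      by_cases hz : x + h • z ∈ 𝒳
      · rw [Set.indicator_of_mem hz, Real.norm_eq_abs, abs_of_nonneg (hp _ hz).1]
        exact (hp _ hz).2
      · rw [Set.indicator_of_notMem hz]
        simpa using hpm

lemma s17G_meas {d : ℕ} (𝒳 : Set (Fin d → ℝ)) (h𝒳 : MeasurableSet 𝒳) (p f : (Fin d → ℝ) → ℝ)
    (hp : Measurable p) (hf : Measurable f) (h : ℝ) :
    Measurable (fun q : (Fin d → ℝ) × (Fin d → ℝ) => s17G 𝒳 p f h q.1 q.2) := by
  unfold s17G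
  have hl : Measurable (fun q : (Fin d → ℝ) × (Fin d → ℝ) => q.1 + h • q.2) := by fun_prop
  refine ((hp.indicator h𝒳).comp hl).mul ((s17phi_meas.comp measurable_snd).mul ?_)
  exact (((hf.comp hl).sub (hf.comp measurable_fst)).div_const h).pow_const 2

/-- Bias step for the unnormalized Laplacian regularizer:
as `h ↓ 0`,
`(1/h²) ∫_X ∫_X (2π)^{−d/2} h^{−d} e^{−‖x−y‖²/(2h²)} (f(x) − f(y))² p(y) p(x) dy dx`
converges to `∫_X ‖∇f(x)‖² p(x)² dx = E_{X∼p}[‖∇f(X)‖² p(X)]`. -/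
theorem stmt17 (d : ℕ) (𝒳 : Set (Fin d → ℝ)) (h𝒳 : IsCompact 𝒳)
    (p : (Fin d → ℝ) → ℝ) (hpmeas : Measurable p) (hp0 : ∀ x, 0 ≤ p x)
    (hp1 : ∫ x in 𝒳, p x = 1)
    (pmin pmax : ℝ) (hpmin : 0 < pmin) (hminmax : pmin ≤ pmax)
    (hpb : ∀ x ∈ 𝒳, pmin ≤ p x ∧ p x ≤ pmax)
    (hpC2 : ContDiff ℝ 2 p)
    (hpbd : ∃ C, ∀ x ∈ 𝒳, ∀ k ≤ 2, ‖iteratedFDeriv ℝ k p x‖ ≤ C)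
    (f : (Fin d → ℝ) → ℝ) (hfC2 : ContDiff ℝ 2 f)
    (hfbd : ∃ C, ∀ x ∈ 𝒳, ∀ k ≤ 2, ‖iteratedFDeriv ℝ k f x‖ ≤ C)
    (hfbdry : ∀ x ∈ frontier 𝒳, fderiv ℝ f x = 0)
    (gradf : (Fin d → ℝ) → (Fin d → ℝ))
    (hgrad : ∀ x i, gradf x i = fderiv ℝ f x (Pi.single i 1)) :
    Tendsto (fun h : ℝ => (1 / h ^ 2) *
        ∫ x in 𝒳, (∫ y in 𝒳,
          (2 * π) ^ (-(d : ℝ) / 2) * h ^ (-(d : ℤ)) *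
            Real.exp (-(∑ i, (x i - y i) ^ 2) / (2 * h ^ 2)) *
            (f x - f y) ^ 2 * p y) * p x)
      (𝓝[>] (0 : ℝ))
      (𝓝 (∫ x in 𝒳, (∑ i, gradf x i ^ 2) * p x ^ 2)) := by
  have hcl := h𝒳.isClosed
  have hms := hcl.measurableSet
  have hp : ∀ x ∈ 𝒳, 0 ≤ p x ∧ p x ≤ pmax := fun x hx => ⟨hp0 x, (hpb x hx).2⟩
  obtain ⟨K, hK⟩ := LocallyLipschitzOn.exists_lipschitzOnWith_of_compact h𝒳
    ((hfC2.of_le one_le_two).locallyLipschitz.locallyLipschitzOn (s := 𝒳))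
  have hfd : Differentiable ℝ f := hfC2.differentiable two_ne_zero
  have hfm : Measurable f := hfC2.continuous.measurable
  have hbint : Integrable
      (fun z : Fin d → ℝ => pmax * (K : ℝ) ^ 2 * ∑ i, s17phi z * (z i * z i)) :=
    (integrable_finsetSum _ fun i _ => s17_integrable i i).const_mul _
  have hpm : 0 ≤ pmax := hpmin.le.trans hminmax
  have hinner : ∀ x ∈ 𝒳, Tendsto (fun h : ℝ => ∫ z, s17G 𝒳 p f h x z) (𝓝[>] 0)
      (𝓝 (p x * ∑ i, gradf x i ^ 2)) := by
    intro x hx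
    have e : p x * ∑ i, gradf x i ^ 2 = ∫ z, p x * (s17phi z * (fderiv ℝ f x z) ^ 2) := by
      rw [integral_const_mul, s17_quad]
      simp_rw [hgrad]
    rw [e]
    refine tendsto_integral_filter_of_dominated_convergence _ ?_ ?_ hbint ?_
    · exact Eventually.of_forall fun h =>
        ((s17G_meas 𝒳 hms p f hpmeas hfm h).comp measurable_prodMk_left).aestronglyMeasurable
    · filter_upwards [self_mem_nhdsWithin] with h hh
      exact ae_of_all _ fun z => s17_bound 𝒳 p f pmax hp K hK h hh x hx z
    · exact ae_of_all _ fun z => s17_ptwise 𝒳 hcl p f hpC2.continuous hfd pmax hp hfbdry x hx z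
  set B : ℝ := ∫ z : Fin d → ℝ, pmax * (K : ℝ) ^ 2 * ∑ i, s17phi z * (z i * z i) with hB
  have hfin : Integrable (fun _ : Fin d → ℝ => B * pmax) (volume.restrict 𝒳) := by
    have : IsFiniteMeasure (volume.restrict 𝒳) := ⟨by simpa using h𝒳.measure_lt_top⟩
    exact integrable_const _
  have key : Tendsto (fun h : ℝ => ∫ x in 𝒳, (∫ z, s17G 𝒳 p f h x z) * p x) (𝓝[>] 0)
      (𝓝 (∫ x in 𝒳, (∑ i, gradf x i ^ 2) * p x ^ 2)) := by
    refine tendsto_integral_filter_of_dominated_convergence _ ?_ ?_ hfin ?_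
    · refine Eventually.of_forall fun h => ?_
      have := (s17G_meas 𝒳 hms p f hpmeas hfm h).stronglyMeasurable.integral_prod_right'
        (ν := (volume : Measure (Fin d → ℝ)))
      exact (this.mul hpmeas.stronglyMeasurable).aestronglyMeasurable
    · filter_upwards [self_mem_nhdsWithin] with h hh
      refine (ae_restrict_iff' hms).2 (ae_of_all _ fun x hx => ?_)
      rw [norm_mul]
      have h1 : ‖∫ z, s17G 𝒳 p f h x z‖ ≤ B :=
        norm_integral_le_of_norm_le hbint
          (ae_of_all _ fun z => s17_bound 𝒳 p f pmax hp K hK h hh x hx z)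
      have h2 : ‖p x‖ ≤ pmax := by
        rw [Real.norm_eq_abs, abs_of_nonneg (hp0 x)]
        exact (hp x hx).2
      exact mul_le_mul h1 h2 (norm_nonneg _) ((norm_nonneg _).trans h1)
    · refine (ae_restrict_iff' hms).2 (ae_of_all _ fun x hx => ?_)
      have := (hinner x hx).mul_const (p x)
      convert this using 2
      ring
  refine key.congr' ?_
  filter_upwards [self_mem_nhdsWithin] with h hh
  rw [← integral_const_mul]
  refine integral_congr_ae (ae_of_all _ fun x => ?_)
  simp only
  rw [← s17_cov 𝒳 hms p f h hh x, mul_assoc]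
end
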